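/- Let N ≥ 2 and let Q₁ = (−1/2,1/2)^{N−1} × (0,1) ⊂ ℝ^N. There exists a constant c ∈ (0,1), depending only on N, with the following property: for every α ∈ (0,1) and all open sets E ⊂ F ⊂ Q₁ such that (i) |E| ≤ (1−α)|Q₁|, and (ii) for every open axis-parallel cube Q ⊂ Q₁ (of arbitrary center and side length), |Q ∩ E| ≥ (1−α)|Q| implies Q ⊂ F, one has |E| ≤ (1−cα)|F|. -/

import Mathlib

open MeasureTheory Metric Set

/-- The open cube `Q_ρ(y)` of center `y` and side length `ρ` (axis-parallel). -/
def cube {N : ℕ} (ρ : ℝ) (y : EuclideanSpace ℝ (Fin N)) :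
    Set (EuclideanSpace ℝ (Fin N)) :=
  {x | ∀ i : Fin N, |x i - y i| < ρ / 2}

section Cube

variable {N : ℕ}

lemma cube_eq_preimage (ρ : ℝ) (y : EuclideanSpace ℝ (Fin N)) :
    cube ρ y = WithLp.ofLp ⁻¹' univ.pi fun i => Ioo (y i - ρ / 2) (y i + ρ / 2) := by
  ext x
  simp only [cube, mem_ofPred_eq, mem_preimage, mem_univ_pi, mem_Ioo, abs_lt]
  exact forall_congr' fun i => by constructor <;> rintro ⟨h₁, h₂⟩ <;> constructor <;> linarith

lemma isOpen_cube (ρ : ℝ) (y : EuclideanSpace ℝ (Fin N)) : IsOpen (cube ρ y) := by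
  rw [cube_eq_preimage]
  exact (isOpen_set_pi finite_univ fun _ _ => isOpen_Ioo).preimage (PiLp.continuous_ofLp 2 _)

lemma volume_cube {ρ : ℝ} (hρ : 0 ≤ ρ) (y : EuclideanSpace ℝ (Fin N)) :
    volume (cube ρ y) = ENNReal.ofReal (ρ ^ N) := by
  rw [cube_eq_preimage, (PiLp.volume_preserving_ofLp (Fin N)).measure_preimage
    (MeasurableSet.univ_pi fun _ => measurableSet_Ioo).nullMeasurableSet, Real.volume_pi_Ioo]
  simp [ENNReal.ofReal_pow hρ]

lemma volume_cube_ne_top {ρ : ℝ} (hρ : 0 ≤ ρ) (y : EuclideanSpace ℝ (Fin N)) :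
    volume (cube ρ y) ≠ ⊤ := by
  simp [volume_cube hρ]

lemma measureReal_cube {ρ : ℝ} (hρ : 0 ≤ ρ) (y : EuclideanSpace ℝ (Fin N)) :
    volume.real (cube ρ y) = ρ ^ N := by
  rw [measureReal_def, volume_cube hρ, ENNReal.toReal_ofReal (by positivity)]

lemma self_mem_cube {ρ : ℝ} (hρ : 0 < ρ) (y : EuclideanSpace ℝ (Fin N)) : y ∈ cube ρ y :=
  fun i => by simpa using hρ

/-- A cube meeting another one of at least half its side lies in the fivefold enlargement
of the latter. -/
lemma cube_subset_cube_five_mul {ρ σ : ℝ} {y z : EuclideanSpace ℝ (Fin N)}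
    (h : (cube ρ y ∩ cube σ z).Nonempty) (hρσ : ρ ≤ 2 * σ) : cube ρ y ⊆ cube (5 * σ) z := by
  obtain ⟨w, hwy, hwz⟩ := h
  intro x hx i
  have h₁ := abs_lt.1 (hx i)
  have h₂ := abs_lt.1 (hwy i)
  have h₃ := abs_lt.1 (hwz i)
  rw [abs_lt]
  constructor <;> linarith [h₁.1, h₁.2, h₂.1, h₂.2, h₃.1, h₃.2]

/-- The cubes of side `s` interpolating between a point `x` of the unit cube centered at `e`
and that cube increase with `s`. -/
lemma cube_lineMap_mono {e x : EuclideanSpace ℝ (Fin N)} (hx : x ∈ cube 1 e) {s t : ℝ}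
    (hst : s ≤ t) :
    cube s (AffineMap.lineMap x e s) ⊆ cube t (AffineMap.lineMap x e t) := by
  intro z hz i
  have h₁ := abs_lt.1 (hz i)
  have h₂ := abs_lt.1 (hx i)
  simp only [AffineMap.lineMap_apply_module, PiLp.add_apply, PiLp.smul_apply,
    smul_eq_mul] at h₁ ⊢
  rw [abs_lt]
  constructor <;> nlinarith [h₁.1, h₁.2, h₂.1, h₂.2]

lemma mem_cube_lineMap {e x : EuclideanSpace ℝ (Fin N)} (hx : x ∈ cube 1 e) {s : ℝ}
    (hs : 0 < s) : x ∈ cube s (AffineMap.lineMap x e s) := by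
  intro i
  have h := abs_lt.1 (hx i)
  simp only [AffineMap.lineMap_apply_module, PiLp.add_apply, PiLp.smul_apply, smul_eq_mul]
  rw [abs_lt]
  constructor <;> nlinarith [h.1, h.2]

lemma exists_cube_lineMap_subset {e x : EuclideanSpace ℝ (Fin N)} (hx : x ∈ cube 1 e)
    {E : Set (EuclideanSpace ℝ (Fin N))} (hE : IsOpen E) (hxE : x ∈ E) :
    ∃ s ∈ Ioc (0 : ℝ) 1, cube s (AffineMap.lineMap x e s) ⊆ E := by
  obtain ⟨ε, hε, hball⟩ := Metric.isOpen_iff.1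
    (hE.preimage (PiLp.continuous_toLp 2 fun _ : Fin N => ℝ)) (WithLp.ofLp x) hxE
  refine ⟨min 1 ε, ⟨by positivity, min_le_left _ _⟩, fun z hz => ?_⟩
  have hs : min 1 ε ≤ ε := min_le_right _ _
  have hs₀ : 0 < min 1 ε := by positivity
  suffices WithLp.ofLp z ∈ Metric.ball (WithLp.ofLp x) ε from hball this
  rw [Metric.mem_ball, dist_pi_lt_iff hε]
  intro i
  have h₁ := abs_lt.1 (hz i)
  have h₂ := abs_lt.1 (hx i)
  simp only [AffineMap.lineMap_apply_module, PiLp.add_apply, PiLp.smul_apply, smul_eq_mul] at h₁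
  rw [Real.dist_eq, abs_lt]
  constructor <;> nlinarith [h₁.1, h₁.2, h₂.1, h₂.2]

lemma continuousOn_measureReal_cube_lineMap_inter {e x : EuclideanSpace ℝ (Fin N)}
    (hx : x ∈ cube 1 e) {E : Set (EuclideanSpace ℝ (Fin N))} (hE : MeasurableSet E) :
    ContinuousOn (fun s : ℝ => volume.real (cube s (AffineMap.lineMap x e s) ∩ E)) (Ici 0) := by
  set Q : ℝ → Set (EuclideanSpace ℝ (Fin N)) := fun s => cube s (AffineMap.lineMap x e s)
  have hfin : ∀ s, 0 ≤ s → volume (Q s) ≠ ⊤ := fun s hs => volume_cube_ne_top hs _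
  have key : ∀ s t, 0 ≤ s → s ≤ t →
      |volume.real (Q t ∩ E) - volume.real (Q s ∩ E)| ≤ |t ^ N - s ^ N| := by
    intro s t hs hst
    have hsub : Q s ⊆ Q t := cube_lineMap_mono hx hst
    have h₁ : volume.real (Q s ∩ E) ≤ volume.real (Q t ∩ E) :=
      measureReal_mono (by gcongr) (measure_ne_top_of_subset inter_subset_left
        (hfin t (hs.trans hst)))
    have h₂ : volume.real (Q s \ E) ≤ volume.real (Q t \ E) :=
      measureReal_mono (by gcongr) (measure_ne_top_of_subset sdiff_subset (hfin t (hs.trans hst)))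
    have h₃ := measureReal_inter_add_sdiff (μ := volume) (s := Q s) hE (hfin s hs)
    have h₄ := measureReal_inter_add_sdiff (μ := volume) (s := Q t) hE (hfin t (hs.trans hst))
    have h₅ : volume.real (Q s) = s ^ N := measureReal_cube hs _
    have h₆ : volume.real (Q t) = t ^ N := measureReal_cube (hs.trans hst) _
    rw [abs_of_nonneg (by linarith)]
    exact le_trans (by linarith) (le_abs_self _)
  intro s hs
  have hlim : Filter.Tendsto (fun t : ℝ => |t ^ N - s ^ N|) (nhdsWithin s (Ici 0)) (nhds 0) := by
    have : Continuous fun t : ℝ => |t ^ N - s ^ N| := by fun_prop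
    simpa using (this.tendsto s).mono_left nhdsWithin_le_nhds
  refine tendsto_iff_dist_tendsto_zero.2 (squeeze_zero' (.of_forall fun _ => dist_nonneg) ?_ hlim)
  filter_upwards [self_mem_nhdsWithin] with t ht
  rw [Real.dist_eq]
  rcases le_total s t with hst | hst
  · exact key s t hs hst
  · rw [abs_sub_comm, abs_sub_comm (t ^ N)]
    exact key t s ht hst

/-- Each point of an open set `E` lies in a subcube of the unit cube in which `E` has density
exactly `1 - α`, provided the density of `E` in the unit cube is at most `1 - α`. -/
lemma exists_cube_volume_inter_eq {e x : EuclideanSpace ℝ (Fin N)} (hx : x ∈ cube 1 e)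
    {E : Set (EuclideanSpace ℝ (Fin N))} (hE : IsOpen E) (hxE : x ∈ E) {α : ℝ}
    (hα : α ∈ Icc (0 : ℝ) 1)
    (hvol : volume (cube 1 e ∩ E) ≤ ENNReal.ofReal (1 - α) * volume (cube 1 e)) :
    ∃ ρ : ℝ, ∃ y : EuclideanSpace ℝ (Fin N), 0 < ρ ∧ ρ ≤ 1 ∧ x ∈ cube ρ y ∧
      cube ρ y ⊆ cube 1 e ∧
      volume (cube ρ y ∩ E) = ENNReal.ofReal (1 - α) * volume (cube ρ y) := by
  obtain ⟨s₀, ⟨hs₀, hs₁⟩, hsub⟩ := exists_cube_lineMap_subset hx hE hxE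
  have hα' : 0 ≤ 1 - α := by linarith [hα.2]
  have hone : cube 1 (AffineMap.lineMap x e (1 : ℝ)) = cube 1 e := by simp
  have hcont : ContinuousOn (fun s : ℝ => volume.real (cube s (AffineMap.lineMap x e s) ∩ E)
      - (1 - α) * s ^ N) (Icc s₀ 1) :=
    ((continuousOn_measureReal_cube_lineMap_inter hx hE.measurableSet).mono
      fun s hs => hs₀.le.trans hs.1).sub (by fun_prop)
  obtain ⟨s, hs, hs_eq⟩ := intermediate_value_Icc' hs₁ hcont (show (0 : ℝ) ∈ _ from by
    constructor
    · have := ENNReal.toReal_mono (ENNReal.mul_ne_top ENNReal.ofReal_ne_top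
        (volume_cube_ne_top zero_le_one e)) hvol
      rw [ENNReal.toReal_mul, ENNReal.toReal_ofReal hα', ← measureReal_def, ← measureReal_def,
        measureReal_cube zero_le_one] at this
      simp only [hone]
      linarith
    · have := pow_nonneg hs₀.le N
      simp only [inter_eq_self_of_subset_left hsub, measureReal_cube hs₀.le]
      nlinarith [hα.1])
  have hs_pos : 0 < s := hs₀.trans_le hs.1
  refine ⟨s, AffineMap.lineMap x e s, hs_pos, hs.2, mem_cube_lineMap hx hs_pos,
    hone ▸ cube_lineMap_mono hx hs.2, ?_⟩
  rw [volume_cube hs_pos.le, ← ENNReal.ofReal_mul hα', ← sub_eq_zero.1 hs_eq,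
    ofReal_measureReal (measure_ne_top_of_subset inter_subset_left
      (volume_cube_ne_top hs_pos.le _))]

/-- Quantitative form of the covering argument: a fixed proportion of `F` lies outside `E`. -/
lemma ofReal_mul_volume_le_volume_diff {e : EuclideanSpace ℝ (Fin N)}
    {E F : Set (EuclideanSpace ℝ (Fin N))} (hE : IsOpen E) (hEQ : E ⊆ cube 1 e) {α : ℝ}
    (hα : α ∈ Icc (0 : ℝ) 1) (hvol : volume E ≤ ENNReal.ofReal (1 - α) * volume (cube 1 e))
    (hF : ∀ ρ : ℝ, 0 < ρ → ∀ y : EuclideanSpace ℝ (Fin N), cube ρ y ⊆ cube 1 e →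
      ENNReal.ofReal (1 - α) * volume (cube ρ y) ≤ volume (cube ρ y ∩ E) → cube ρ y ⊆ F) :
    ENNReal.ofReal α * volume E ≤ ENNReal.ofReal (5 ^ N) * volume (F \ E) := by
  let B : ℝ × EuclideanSpace ℝ (Fin N) → Set (EuclideanSpace ℝ (Fin N)) := fun p => cube p.1 p.2
  let t : Set (ℝ × EuclideanSpace ℝ (Fin N)) := {p | 0 < p.1 ∧ p.1 ≤ 1 ∧ B p ⊆ cube 1 e ∧
    volume (B p ∩ E) = ENNReal.ofReal (1 - α) * volume (B p)}
  obtain ⟨u, hut, hdisj, hcov⟩ := Vitali.exists_disjoint_subfamily_covering_enlargement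
    B t Prod.fst 2 one_lt_two (fun p hp => hp.1.le) 1 (fun p hp => hp.2.1)
    (fun p hp => ⟨p.2, self_mem_cube hp.1 p.2⟩)
  have hu : u.Countable := hdisj.countable_of_isOpen (fun p _ => isOpen_cube _ _)
    fun p hp => ⟨p.2, self_mem_cube (hut hp).1 p.2⟩
  have hEu : E ⊆ ⋃ p ∈ u, cube (5 * p.1) p.2 := by
    intro x hx
    obtain ⟨ρ, y, hρ, hρ₁, hxy, hsub, hy⟩ := exists_cube_volume_inter_eq (hEQ hx) hE hx hα
      (by rwa [inter_eq_self_of_subset_right hEQ])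
    obtain ⟨p, hp, hne, hle⟩ := hcov (ρ, y) ⟨hρ, hρ₁, hsub, hy⟩
    exact mem_biUnion hp (cube_subset_cube_five_mul hne hle hxy)
  have hdiff : ∀ p ∈ u, ENNReal.ofReal α * volume (B p) = volume (B p \ E) := by
    intro p hp
    obtain ⟨hp₀, -, -, hp_eq⟩ := hut hp
    have hfin : volume (B p) ≠ ⊤ := volume_cube_ne_top hp₀.le _
    have hadd := measure_inter_add_sdiff (μ := volume) (B p) hE.measurableSet
    rw [hp_eq] at hadd
    refine (ENNReal.add_right_inj (ENNReal.mul_ne_top ENNReal.ofReal_ne_top hfin)).1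
      (Eq.trans ?_ hadd.symm)
    rw [← add_mul, ← ENNReal.ofReal_add (by linarith [hα.2]) hα.1]
    simp
  have hmul : ∀ p ∈ u, volume (cube (5 * p.1) p.2) = ENNReal.ofReal (5 ^ N) * volume (B p) := by
    intro p hp
    have hp₀ : 0 ≤ p.1 := (hut hp).1.le
    rw [volume_cube (by positivity), volume_cube hp₀, ← ENNReal.ofReal_mul (by positivity),
      mul_pow]
  have hBF : ⋃ p ∈ u, B p \ E ⊆ F \ E := iUnion₂_subset fun p hp =>
    sdiff_subset_sdiff_left (hF p.1 (hut hp).1 p.2 (hut hp).2.2.1 (hut hp).2.2.2.ge)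
  calc ENNReal.ofReal α * volume E
      ≤ ENNReal.ofReal α * ∑' p : u, volume (cube (5 * p.1.1) p.1.2) := by
        gcongr
        exact (measure_mono hEu).trans (measure_biUnion_le _ hu _)
    _ = ENNReal.ofReal (5 ^ N) * ∑' p : u, volume (B p \ E) := by
        rw [← ENNReal.tsum_mul_left, ← ENNReal.tsum_mul_left]
        refine tsum_congr fun p => ?_
        rw [hmul p p.2, ← hdiff p p.2, mul_left_comm]
    _ = ENNReal.ofReal (5 ^ N) * volume (⋃ p ∈ u, B p \ E) := by
        rw [measure_biUnion hu (hdisj.mono fun _ => sdiff_subset)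
          fun p _ => (isOpen_cube _ _).measurableSet.diff hE.measurableSet]
    _ ≤ ENNReal.ofReal (5 ^ N) * volume (F \ E) := by gcongr

end Cube

/-- Measure-theoretic covering lemma (Lemma 3.4, Imbert–Silvestre), on the cube
`Q₁ = (-1/2,1/2)^{N-1} × (0,1) = cube 1 e` with `e = (0,…,0,1/2)`. -/
theorem stmt_13 {N : ℕ} (hN : 2 ≤ N) :
    ∃ c : ℝ, c ∈ Ioo (0 : ℝ) 1 ∧
      ∀ α ∈ Ioo (0 : ℝ) 1, ∀ E F : Set (EuclideanSpace ℝ (Fin N)),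
        IsOpen E → IsOpen F → E ⊆ F →
        F ⊆ cube 1 (EuclideanSpace.single (⟨N - 1, by omega⟩ : Fin N) (1 / 2)) →
        volume E ≤ ENNReal.ofReal (1 - α) *
          volume (cube 1 (EuclideanSpace.single (⟨N - 1, by omega⟩ : Fin N) (1 / 2))) →
        (∀ ρ : ℝ, 0 < ρ → ∀ y : EuclideanSpace ℝ (Fin N),
          cube ρ y ⊆ cube 1 (EuclideanSpace.single (⟨N - 1, by omega⟩ : Fin N) (1 / 2)) →
          ENNReal.ofReal (1 - α) * volume (cube ρ y) ≤ volume (cube ρ y ∩ E) →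
          cube ρ y ⊆ F) →
        volume E ≤ ENNReal.ofReal (1 - c * α) * volume F := by
  have h5 : (1 : ℝ) ≤ 5 ^ N := one_le_pow₀ (by norm_num)
  have hc : (5 ^ N : ℝ)⁻¹ ≤ 1 := inv_le_one_of_one_le₀ h5
  have hc₀ : (0 : ℝ) < (5 ^ N)⁻¹ := by positivity
  refine ⟨(5 ^ N)⁻¹ / 2, ⟨by positivity, by linarith⟩, ?_⟩
  intro α hα E F hE hF hEF hFQ hvol hcubes
  have hF_fin : volume F ≠ ⊤ := measure_ne_top_of_subset hFQ (volume_cube_ne_top zero_le_one _)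
  have hE_fin : volume E ≠ ⊤ := measure_ne_top_of_subset hEF hF_fin
  have hD_fin : volume (F \ E) ≠ ⊤ := measure_ne_top_of_subset sdiff_subset hF_fin
  have hmain := ENNReal.toReal_mono (ENNReal.mul_ne_top ENNReal.ofReal_ne_top hD_fin)
    (ofReal_mul_volume_le_volume_diff hE (hEF.trans hFQ) ⟨hα.1.le, hα.2.le⟩ hvol hcubes)
  rw [ENNReal.toReal_mul, ENNReal.toReal_mul, ENNReal.toReal_ofReal hα.1.le,
    ENNReal.toReal_ofReal (by positivity), ← measureReal_def, ← measureReal_def] at hmain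
  have hadd := measureReal_sdiff_add_inter (μ := volume) (s := F) hE.measurableSet hF_fin
  rw [inter_eq_self_of_subset_right hEF] at hadd
  set a := volume.real E
  set d := volume.real (F \ E)
  set k : ℝ := (5 ^ N)⁻¹
  have ha : 0 ≤ a := measureReal_nonneg
  have hd : k * α * a ≤ d := by
    calc k * α * a = k * (α * a) := by ring
      _ ≤ k * (5 ^ N * d) := by gcongr
      _ = d := by rw [← mul_assoc, inv_mul_cancel₀ (by positivity), one_mul]
  have hkα : k * α ≤ 1 := mul_le_one₀ hc hα.1.le hα.2.le
  have hd₀ : 0 ≤ d := measureReal_nonneg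
  have hfactor : 0 ≤ 1 - k / 2 * α := by linarith
  rw [← ofReal_measureReal hE_fin, ← ofReal_measureReal hF_fin, ← ENNReal.ofReal_mul hfactor]
  refine ENNReal.ofReal_le_ofReal ?_
  rw [← hadd]
  nlinarith [mul_nonneg (sub_nonneg.2 hkα) hd₀]
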